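/- arXiv:1404.1782 — 5 statements merged into one kernel-verified Lean document; each statement's English description precedes it below -/
import Mathlib

section
/- Fix reals t, c, p̃, q_N, q_NN with t > 0, and write Δq = q_NN − q_N. Let p_N* = t + c + Δq/3 − p̃/3 and p_NN* = t + c − Δq/3 − 2p̃/3. Then (p_N*, p_NN*) is the unique Nash equilibrium of the pricing game: p_NN* maximizes p ↦ (p + p̃ − c)·(1/2 − (p − p_N* + Δq)/(2t)) over ℝ, p_N* maximizes p ↦ (p − c)·(1/2 + (p_NN* − p + Δq)/(2t)) over ℝ, and any pair (p_N, p_NN) with each price maximizing its owner's payoff given the other equals (p_N*, p_NN*). -/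
/-- A concave quadratic payoff with roots `a` and `s` is maximized exactly at the midpoint. -/
theorem isMax_quadratic_payoff_iff {t : ℝ} (ht : 0 < t) (a s x : ℝ) :
    (∀ p : ℝ, (p - a) * ((s - p) / (2 * t)) ≤ (x - a) * ((s - x) / (2 * t))) ↔
      x = (a + s) / 2 := by
  have h2t : 0 < 2 * t := by positivity
  simp only [← mul_div_assoc, div_le_div_iff_of_pos_right h2t]
  constructor
  · intro h
    have hsq : (x - (a + s) / 2) ^ 2 = 0 :=
      le_antisymm (by linarith [h ((a + s) / 2)]) (sq_nonneg _)
    exact sub_eq_zero.mp (pow_eq_zero_iff two_ne_zero |>.mp hsq)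
  · rintro rfl p
    linarith [sq_nonneg (p - (a + s) / 2)]

/-- The stage-3 pricing game has the unique Nash equilibrium
`p_N* = t + c + Δq/3 − p̃/3`, `p_NN* = t + c − Δq/3 − 2p̃/3`. -/
theorem pricing_nash_equilibrium (t c ptil qN qNN : ℝ) (ht : 0 < t) :
    let Δq := qNN - qN
    let pNstar := t + c + Δq / 3 - ptil / 3
    let pNNstar := t + c - Δq / 3 - 2 * ptil / 3
    let πNN : ℝ → ℝ → ℝ := fun p pN => (p + ptil - c) * (1 / 2 - (p - pN + Δq) / (2 * t))
    let πN : ℝ → ℝ → ℝ := fun p pNN => (p - c) * (1 / 2 + (pNN - p + Δq) / (2 * t))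
    (∀ p : ℝ, πNN p pNstar ≤ πNN pNNstar pNstar) ∧
    (∀ p : ℝ, πN p pNNstar ≤ πN pNstar pNNstar) ∧
    (∀ pN pNN : ℝ,
      (∀ p : ℝ, πNN p pN ≤ πNN pNN pN) →
      (∀ p : ℝ, πN p pNN ≤ πN pN pNN) →
      pN = pNstar ∧ pNN = pNNstar) := by
  intro Δq pNstar pNNstar πNN πN
  have best_NN (x pN : ℝ) :
      (∀ p, πNN p pN ≤ πNN x pN) ↔ x = (c - ptil + (t + pN - Δq)) / 2 := by
    rw [← isMax_quadratic_payoff_iff ht]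
    have payoff (p : ℝ) :
        πNN p pN = (p - (c - ptil)) * ((t + pN - Δq - p) / (2 * t)) := by
      simp only [πNN]
      field_simp
      ring
    simp only [payoff]
  have best_N (x pNN : ℝ) :
      (∀ p, πN p pNN ≤ πN x pNN) ↔ x = (c + (t + pNN + Δq)) / 2 := by
    rw [← isMax_quadratic_payoff_iff ht]
    have payoff (p : ℝ) : πN p pNN = (p - c) * ((t + pNN + Δq - p) / (2 * t)) := by
      simp only [πN]
      field_simp
      ring
    simp only [payoff]
  simp only [best_NN, best_N, pNstar, pNNstar]
  refine ⟨by ring, by ring, fun pN pNN hNN hN => ⟨?_, ?_⟩⟩ <;> linarith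
end

section
/- Fix reals t, v*, p̃ with t > 0. Let π_G(q_N, q_NN) = (q_NN − p̃)·(1/2 − (q_NN − q_N − p̃)/(6t)) + q_N·(1/2 + (q_NN − q_N − p̃)/(6t)), and call (q_N, q_NN) feasible if: (i) q_NN − q_N ≥ p̃ implies q_N ≤ v* − t/2 and q_NN ≤ v* − t/2 + (q_NN − q_N − p̃)/6, and (ii) q_NN − q_N ≤ p̃ implies q_NN ≤ v* − t/2 and q_N ≤ v* − t/2 − (q_NN − q_N − p̃)/6. If (q_N, q_NN) is feasible and both inequalities in the applicable constraint set are strict (neither q_N nor q_NN equals its upper bound), then there exists a feasible (q_N', q_NN') with π_G(q_N', q_NN') > π_G(q_N, q_NN); consequently, at any maximizer of π_G over the feasible set, at least one of q_N, q_NN equals its upper bound. -/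
/-- Content provider's stage-2 payoff. -/
noncomputable def piG (t ptil qN qNN : ℝ) : ℝ :=
  (qNN - ptil) * (1 / 2 - (qNN - qN - ptil) / (6 * t)) +
    qN * (1 / 2 + (qNN - qN - ptil) / (6 * t))

/-- Full-coverage feasibility constraints for the content provider. -/
def Feasible (t vstar ptil qN qNN : ℝ) : Prop :=
  (qNN - qN ≥ ptil →
    qN ≤ vstar - t / 2 ∧ qNN ≤ vstar - t / 2 + (qNN - qN - ptil) / 6) ∧
  (qNN - qN ≤ ptil →
    qNN ≤ vstar - t / 2 ∧ qN ≤ vstar - t / 2 - (qNN - qN - ptil) / 6)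

/-- Raising both fees by the same amount raises the payoff by that amount. -/
theorem piG_add_add (t ptil qN qNN e : ℝ) :
    piG t ptil (qN + e) (qNN + e) = piG t ptil qN qNN + e := by
  simp only [piG, add_sub_add_right_eq_sub]
  ring

/-- A point whose applicable constraints are strict stays feasible under a small common
increase of both fees. -/
theorem exists_pos_feasible_add (t vstar ptil qN qNN : ℝ)
    (h : (qNN - qN ≥ ptil →
          qN < vstar - t / 2 ∧ qNN < vstar - t / 2 + (qNN - qN - ptil) / 6) ∧
       (qNN - qN ≤ ptil →
          qNN < vstar - t / 2 ∧ qN < vstar - t / 2 - (qNN - qN - ptil) / 6)) :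
    ∃ e > 0, Feasible t vstar ptil (qN + e) (qNN + e) := by
  rcases le_total ptil (qNN - qN) with hd | hd
  · obtain ⟨h1, h2⟩ := h.1 hd
    obtain ⟨e, he, hlt⟩ := exists_between (lt_min (sub_pos.2 h1) (sub_pos.2 h2))
    obtain ⟨he1, he2⟩ := lt_min_iff.1 hlt
    refine ⟨e, he, fun _ => ⟨?_, ?_⟩, fun _ => ⟨?_, ?_⟩⟩ <;> linarith
  · obtain ⟨h1, h2⟩ := h.2 hd
    obtain ⟨e, he, hlt⟩ := exists_between (lt_min (sub_pos.2 h1) (sub_pos.2 h2))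
    obtain ⟨he1, he2⟩ := lt_min_iff.1 hlt
    refine ⟨e, he, fun _ => ⟨?_, ?_⟩, fun _ => ⟨?_, ?_⟩⟩ <;> linarith

/-- If a feasible point has both constraints of the applicable set strict, then it can be
strictly improved upon; consequently, at a maximizer at least one of `q_N`, `q_NN`
equals its upper bound. -/
theorem boundary_at_optimum (t vstar ptil : ℝ) (ht : 0 < t) :
    (∀ qN qNN : ℝ, Feasible t vstar ptil qN qNN →
      ((qNN - qN ≥ ptil →
          qN < vstar - t / 2 ∧ qNN < vstar - t / 2 + (qNN - qN - ptil) / 6) ∧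
       (qNN - qN ≤ ptil →
          qNN < vstar - t / 2 ∧ qN < vstar - t / 2 - (qNN - qN - ptil) / 6)) →
      ∃ qN' qNN' : ℝ, Feasible t vstar ptil qN' qNN' ∧
        piG t ptil qN qNN < piG t ptil qN' qNN') ∧
    (∀ qN qNN : ℝ, Feasible t vstar ptil qN qNN →
      (∀ qN' qNN' : ℝ, Feasible t vstar ptil qN' qNN' →
        piG t ptil qN' qNN' ≤ piG t ptil qN qNN) →
      ((qNN - qN ≥ ptil ∧
          (qN = vstar - t / 2 ∨ qNN = vstar - t / 2 + (qNN - qN - ptil) / 6)) ∨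
       (qNN - qN ≤ ptil ∧
          (qNN = vstar - t / 2 ∨ qN = vstar - t / 2 - (qNN - qN - ptil) / 6)))) := by
  have improve : ∀ qN qNN : ℝ,
      ((qNN - qN ≥ ptil →
          qN < vstar - t / 2 ∧ qNN < vstar - t / 2 + (qNN - qN - ptil) / 6) ∧
       (qNN - qN ≤ ptil →
          qNN < vstar - t / 2 ∧ qN < vstar - t / 2 - (qNN - qN - ptil) / 6)) →
      ∃ qN' qNN' : ℝ, Feasible t vstar ptil qN' qNN' ∧
        piG t ptil qN qNN < piG t ptil qN' qNN' := by
    intro qN qNN h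
    obtain ⟨e, he, hf⟩ := exists_pos_feasible_add t vstar ptil qN qNN h
    exact ⟨qN + e, qNN + e, hf, by rw [piG_add_add]; linarith⟩
  refine ⟨fun qN qNN _ h => improve qN qNN h, fun qN qNN hf hmax => ?_⟩
  by_contra hcon
  rw [not_or, not_and, not_and, not_or, not_or] at hcon
  obtain ⟨qN', qNN', hf', hlt⟩ := improve qN qNN
    ⟨fun hd => ⟨lt_of_le_of_ne (hf.1 hd).1 (hcon.1 hd).1,
      lt_of_le_of_ne (hf.1 hd).2 (hcon.1 hd).2⟩,
     fun hd => ⟨lt_of_le_of_ne (hf.2 hd).1 (hcon.2 hd).1,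
      lt_of_le_of_ne (hf.2 hd).2 (hcon.2 hd).2⟩⟩
  exact (hmax qN' qNN' hf').not_gt hlt
end

section
/- Fix reals t, v*, p̃ with t > 0 and p̃ ≤ −5t/4. Then the pair (q_N, q_NN) with q_N = v* − t/2 and q_NN = q_N + p̃ + 3t/2 is feasible and maximizes π_G over the feasible set; in particular the optimal subscription-fee difference is Δq = p̃ + 3t/2. -/
/-- The payoff in terms of `qN` and the fee difference net of `ptil`. -/
lemma piG_eq (t ptil qN qNN : ℝ) (ht : t ≠ 0) :
    piG t ptil qN qNN =
      qN + 3 * t / 8 - (qNN - qN - ptil - 3 * t / 2) ^ 2 / (6 * t) := by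
  unfold piG
  field_simp
  ring

/-- For p̃ ≤ −5t/4 the CP's optimum is q_N = v* − t/2, q_NN = q_N + p̃ + 3t/2. -/
theorem cp_optimum_low (t vstar ptil : ℝ) (ht : 0 < t) (hp : ptil ≤ -5 * t / 4) :
    let qN := vstar - t / 2
    let qNN := qN + ptil + 3 * t / 2
    Feasible t vstar ptil qN qNN ∧
    (∀ qN' qNN' : ℝ, Feasible t vstar ptil qN' qNN' →
      piG t ptil qN' qNN' ≤ piG t ptil qN qNN) ∧
    qNN - qN = ptil + 3 * t / 2 := by
  intro qN qNN
  have hd : qNN - qN = ptil + 3 * t / 2 := by simp only [qNN]; ring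
  refine ⟨⟨fun _ => ⟨le_rfl, ?_⟩, fun h => by linarith⟩, fun a b hab => ?_, hd⟩
  · rw [hd]
    simp only [qNN, qN]
    linarith
  · rw [piG_eq t ptil a b ht.ne', piG_eq t ptil qN qNN ht.ne', hd]
    have hz : (ptil + 3 * t / 2 - ptil - 3 * t / 2) ^ 2 / (6 * t) = 0 := by
      ring
    rcases le_total ptil (b - a) with h | h
    · have ha : a ≤ qN := (hab.1 h).1
      have hsq : 0 ≤ (b - a - ptil - 3 * t / 2) ^ 2 / (6 * t) := by positivity
      linarith
    · have ha : a ≤ qN - (b - a - ptil) / 6 := (hab.2 h).2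
      have hsq : 3 * t / 8 - (b - a - ptil) / 2 ≤
          (b - a - ptil - 3 * t / 2) ^ 2 / (6 * t) := by
        rw [le_div_iff₀ (by positivity)]
        nlinarith [sq_nonneg (b - a - ptil)]
      linarith
end

section
/- Fix reals t, v*, p̃ with t > 0. Define h : ℝ → ℝ by h(Δq) = π_G(q_NN(Δq) − Δq, q_NN(Δq)) where q_NN(Δq) = v* − t/2 + (Δq − p̃)/6, i.e., the content provider's payoff along the boundary q_NN = v* − t/2 + (Δq − p̃)/6, q_N = q_NN − Δq. Then h is strictly concave on ℝ and has a unique global maximum at Δq = p̃ − t; in particular this stationary point satisfies Δq < p̃, so it violates the constraint Δq ≥ p̃ of the first candidate set. -/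
/-- Completed-square form of the payoff along the boundary. -/
theorem piG_boundary_eq (t vstar ptil x : ℝ) (ht : t ≠ 0) :
    piG t ptil (vstar - t / 2 + (x - ptil) / 6 - x) (vstar - t / 2 + (x - ptil) / 6) =
      vstar - ptil - t / 3 - (x - (ptil - t)) ^ 2 / (6 * t) := by
  unfold piG
  field_simp
  ring

/-- Along the boundary q_NN = v* − t/2 + (Δq − p̃)/6, q_N = q_NN − Δq, the CP's payoff
is strictly concave with unique global maximum at Δq = p̃ − t, which violates the
constraint Δq ≥ p̃ of the first candidate set. -/
theorem first_candidate_set_infeasible_stationary (t vstar ptil : ℝ) (ht : 0 < t) :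
    let qNNb : ℝ → ℝ := fun Δq => vstar - t / 2 + (Δq - ptil) / 6
    let h : ℝ → ℝ := fun Δq => piG t ptil (qNNb Δq - Δq) (qNNb Δq)
    StrictConcaveOn ℝ Set.univ h ∧
    (∀ x : ℝ, h x ≤ h (ptil - t)) ∧
    (∀ x : ℝ, h x = h (ptil - t) → x = ptil - t) ∧
    ptil - t < ptil := by
  intro qNNb h
  have h_eq (x : ℝ) : h x = vstar - ptil - t / 3 - (x - (ptil - t)) ^ 2 / (6 * t) :=
    piG_boundary_eq t vstar ptil x ht.ne'
  have h_max : h (ptil - t) = vstar - ptil - t / 3 := by simp [h_eq]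
  refine ⟨⟨convex_univ, ?_⟩, fun x => ?_, fun x hx => ?_, by linarith⟩
  · intro x _ y _ hxy a b ha hb hab
    obtain rfl : b = 1 - a := by linarith
    have hpos : 0 < a * (1 - a) * (x - y) ^ 2 / (6 * t) := by
      have := sq_pos_of_ne_zero (sub_ne_zero.mpr hxy)
      positivity
    simp only [h_eq, smul_eq_mul]
    refine sub_pos.mp (hpos.trans_eq ?_)
    ring
  · rw [h_max, h_eq]
    have : 0 ≤ (x - (ptil - t)) ^ 2 / (6 * t) := by positivity
    linarith
  · rw [h_max, h_eq, sub_eq_self, div_eq_zero_iff] at hx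
    have hsq := hx.resolve_right (by positivity)
    exact sub_eq_zero.mp (pow_eq_zero_iff two_ne_zero |>.mp hsq)
end

section
/- Fix t > 0 and define f : ℝ → ℝ by f(p̃) = t/8 if p̃ ≤ −5t/4, f(p̃) = (t + 2p̃/5)·(1/2 + p̃/(5t)) if −5t/4 ≤ p̃ ≤ 5t/4, and f(p̃) = 9t/8 if p̃ ≥ 5t/4 (the two formulas agree at the breakpoints). Then f(p̃) ≤ 9t/8 for every p̃ ∈ ℝ, with equality if and only if p̃ ≥ 5t/4; consequently the set of maximizers of f is {p̃ : p̃ ≥ 5t/4}. -/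
/-- The non-neutral ISP's stage-1 equilibrium payoff as a function of p̃. -/
noncomputable def stage1Payoff (t ptil : ℝ) : ℝ :=
  if ptil ≤ -5 * t / 4 then t / 8
  else if ptil ≤ 5 * t / 4 then (t + 2 * ptil / 5) * (1 / 2 + ptil / (5 * t))
  else 9 * t / 8

theorem stage1Payoff_middle_eq {t : ℝ} (ht : 0 < t) (p : ℝ) :
    (t + 2 * p / 5) * (1 / 2 + p / (5 * t)) = (t + 2 * p / 5) ^ 2 / (2 * t) := by
  field_simp

theorem stage1Payoff_of_ge {t : ℝ} (ht : 0 < t) {p : ℝ} (hp : 5 * t / 4 ≤ p) :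
    stage1Payoff t p = 9 * t / 8 := by
  unfold stage1Payoff
  rw [if_neg (by linarith)]
  split_ifs with h
  · obtain rfl : p = 5 * t / 4 := le_antisymm h hp
    field_simp
    norm_num
  · rfl

theorem stage1Payoff_lt_of_lt {t : ℝ} (ht : 0 < t) {p : ℝ} (hp : p < 5 * t / 4) :
    stage1Payoff t p < 9 * t / 8 := by
  unfold stage1Payoff
  split_ifs with h₁ h₂
  · linarith
  · rw [stage1Payoff_middle_eq ht, div_lt_iff₀ (by positivity)]
    nlinarith
  · exact absurd hp.le h₂

/-- The stage-1 payoff is bounded by 9t/8, attained exactly when p̃ ≥ 5t/4; the two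
formulas agree at the breakpoints, and the maximizer set is {p̃ : p̃ ≥ 5t/4}. -/
theorem stage1_optimal_fee (t : ℝ) (ht : 0 < t) :
    ((t + 2 * (-5 * t / 4) / 5) * (1 / 2 + (-5 * t / 4) / (5 * t)) = t / 8) ∧
    ((t + 2 * (5 * t / 4) / 5) * (1 / 2 + (5 * t / 4) / (5 * t)) = 9 * t / 8) ∧
    (∀ ptil : ℝ, stage1Payoff t ptil ≤ 9 * t / 8) ∧
    (∀ ptil : ℝ, stage1Payoff t ptil = 9 * t / 8 ↔ ptil ≥ 5 * t / 4) ∧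
    {ptil : ℝ | ∀ p : ℝ, stage1Payoff t p ≤ stage1Payoff t ptil}
      = {ptil : ℝ | ptil ≥ 5 * t / 4} := by
  have hle (p : ℝ) : stage1Payoff t p ≤ 9 * t / 8 := by
    rcases le_or_gt (5 * t / 4) p with hp | hp
    · exact (stage1Payoff_of_ge ht hp).le
    · exact (stage1Payoff_lt_of_lt ht hp).le
  have hiff (p : ℝ) : stage1Payoff t p = 9 * t / 8 ↔ p ≥ 5 * t / 4 :=
    ⟨fun h => le_of_not_gt fun hp => (stage1Payoff_lt_of_lt ht hp).ne h,
      stage1Payoff_of_ge ht⟩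
  refine ⟨?_, ?_, hle, hiff, ?_⟩
  · field_simp
    norm_num
  · field_simp
    norm_num
  · ext p
    simp only [Set.mem_ofPred_eq]
    rw [← hiff p]
    refine ⟨fun h => le_antisymm (hle p) ?_, fun h q => h ▸ hle q⟩
    exact (stage1Payoff_of_ge ht le_rfl).ge.trans (h (5 * t / 4))
end
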